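/- If Γ is a simplicial forest, then all well ordered facet covers of Γ have the same cardinality. -/

import Mathlib

open Classical

variable {α : Type*} [DecidableEq α]

/-- The vertex set of a simplicial complex given by its finset of facets. -/
def vertexSet (Δ : Finset (Finset α)) : Finset α := Δ.sup id

/-- `D` is a facet cover of the complex with facet set `Δ` and vertex set `V`:
every vertex belongs to some facet of `D`. -/
def IsFacetCover (V : Finset α) (Δ D : Finset (Finset α)) : Prop :=
  D ⊆ Δ ∧ ∀ v ∈ V, ∃ F ∈ D, v ∈ F

/-- A minimal facet cover: no proper subset is a facet cover. -/
def IsMinimalFacetCover (V : Finset α) (Δ D : Finset (Finset α)) : Prop :=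
  IsFacetCover V Δ D ∧ ∀ D' ⊂ D, ¬IsFacetCover V Δ D'

/-- Union of a list of finsets. -/
def listUnion (L : List (Finset α)) : Finset α := L.foldr (· ∪ ·) ∅

/-- A sequence of facets `L = [F_1, ..., F_k]` is a well ordered facet cover of the complex
with facet set `Δ` and vertex set `V`: it is a minimal facet cover and for every facet
`H ∉ {F_1, ..., F_k}` there is `i ≤ k - 1` with `F_i ⊆ H ∪ F_{i+1} ∪ ⋯ ∪ F_k`. -/
def IsWellOrderedFacetCover (V : Finset α) (Δ : Finset (Finset α))
    (L : List (Finset α)) : Prop :=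
  L.Nodup ∧ (∀ F ∈ L, F ∈ Δ) ∧ IsMinimalFacetCover V Δ L.toFinset ∧
    ∀ H ∈ Δ, H ∉ L → ∃ i : ℕ, ∃ h : i + 1 < L.length,
      L.get ⟨i, Nat.lt_of_succ_lt h⟩ ⊆ H ∪ listUnion (L.drop (i + 1))

/-- `F` is a leaf of the complex with facet set `Δ`. -/
def IsLeaf (Δ : Finset (Finset α)) (F : Finset α) : Prop :=
  F ∈ Δ ∧ (Δ = {F} ∨ ∃ G ∈ Δ, G ≠ F ∧ ∀ H ∈ Δ, H ≠ F → F ∩ H ⊆ G)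

/-- A simplicial forest: every nonempty subcollection has a leaf. -/
def IsSimplicialForest (Γ : Finset (Finset α)) : Prop :=
  ∀ Δ ⊆ Γ, Δ.Nonempty → ∃ F, IsLeaf Δ F

/-- `D ⊆ Γ` is an irredundant cover of `X`, and every `H ∈ Γ` outside `D` covers, together with
the members of `D` of larger rank than some `F ∈ D`, all the points of `F ∩ X`. Irredundance is
expressed by private points. Unlike for facet covers, `Γ` need not be an antichain. -/
structure IsRankedCover (X : Finset α) (Γ D : Finset (Finset α)) (r : Finset α → ℕ) : Prop where
  subset : D ⊆ Γ
  cover : ∀ v ∈ X, ∃ F ∈ D, v ∈ F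
  exists_private : ∀ F ∈ D, ∃ v ∈ X, v ∈ F ∧ ∀ F' ∈ D, F' ≠ F → v ∉ F'
  ordered : ∀ H ∈ Γ, H ∉ D → ∃ F ∈ D, ∀ v ∈ X, v ∈ F → v ∈ H ∨ ∃ F' ∈ D, r F < r F' ∧ v ∈ F'

/-- A member of `Γ` with a free point in `X` can be removed together with all its points. -/
theorem IsRankedCover.erase_of_free {X : Finset α} {Γ D : Finset (Finset α)} {r : Finset α → ℕ}
    (h : IsRankedCover X Γ D r) {F : Finset α} {v : α} (hvX : v ∈ X) (hvF : v ∈ F)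
    (hfree : ∀ H ∈ Γ, H ≠ F → v ∉ H) :
    F ∈ D ∧ IsRankedCover (X \ F) (Γ.erase F) (D.erase F) r := by
  have hFD : F ∈ D := by
    obtain ⟨F', hF', hv⟩ := h.cover v hvX
    by_contra hF
    exact hfree F' (h.subset hF') (fun e => hF (e ▸ hF')) hv
  refine ⟨hFD, Finset.erase_subset_erase _ h.subset, ?_, ?_, ?_⟩
  · intro w hw
    obtain ⟨hwX, hwF⟩ := Finset.mem_sdiff.1 hw
    obtain ⟨F', hF', hw'⟩ := h.cover w hwX
    exact ⟨F', Finset.mem_erase.2 ⟨fun e => hwF (e ▸ hw'), hF'⟩, hw'⟩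
  · intro A hA
    obtain ⟨hAF, hAD⟩ := Finset.mem_erase.1 hA
    obtain ⟨w, hwX, hwA, hw⟩ := h.exists_private A hAD
    exact ⟨w, Finset.mem_sdiff.2 ⟨hwX, hw F hFD (Ne.symm hAF)⟩, hwA,
      fun F' hF' => hw F' (Finset.mem_of_mem_erase hF')⟩
  · intro H hH hHD
    obtain ⟨hHF, hHΓ⟩ := Finset.mem_erase.1 hH
    have hHD' : H ∉ D := fun e => hHD (Finset.mem_erase.2 ⟨hHF, e⟩)
    obtain ⟨A, hA, hAcov⟩ := h.ordered H hHΓ hHD'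
    have hAF : A ≠ F := by
      rintro rfl
      rcases hAcov v hvX hvF with hv | ⟨F', hF', hr, hv⟩
      · exact hfree H hHΓ hHF hv
      · exact hfree F' (h.subset hF') (fun e => by simp [e] at hr) hv
    refine ⟨A, Finset.mem_erase.2 ⟨hAF, hA⟩, fun w hw hwA => ?_⟩
    obtain ⟨hwX, hwF⟩ := Finset.mem_sdiff.1 hw
    exact (hAcov w hwX hwA).imp_right fun ⟨F', hF', hr, hw'⟩ =>
      ⟨F', Finset.mem_erase.2 ⟨fun e => hwF (e ▸ hw'), hF'⟩, hr, hw'⟩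

/-- If `F ∩ X ⊆ G`, then `G` can be removed from `Γ`: a ranked cover using `G` stays a ranked
cover after replacing `G` by `F`. -/
theorem IsRankedCover.exists_erase_of_subset {X : Finset α} {Γ D : Finset (Finset α)}
    {r : Finset α → ℕ} (h : IsRankedCover X Γ D r) {F G : Finset α} (hF : F ∈ Γ)
    (hFG : F ≠ G) (hsub : ∀ v ∈ X, v ∈ F → v ∈ G) :
    ∃ D' r', IsRankedCover X (Γ.erase G) D' r' ∧ D'.card = D.card := by
  by_cases hGD : G ∈ D
  swap
  · refine ⟨D, r, ⟨?_, h.cover, h.exists_private, ?_⟩, rfl⟩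
    · exact fun A hA => Finset.mem_erase.2 ⟨fun e => hGD (e ▸ hA), h.subset hA⟩
    · exact fun H hH => h.ordered H (Finset.mem_of_mem_erase hH)
  have hFD : F ∉ D := by
    intro hFD
    obtain ⟨v, hvX, hvF, hv⟩ := h.exists_private F hFD
    exact hv G hGD hFG.symm (hsub v hvX hvF)
  have hGcov : ∀ v ∈ X, v ∈ G → v ∈ F ∨ ∃ F' ∈ D, r G < r F' ∧ v ∈ F' := by
    obtain ⟨A, hA, hAcov⟩ := h.ordered F hF hFD
    obtain rfl | hAG := eq_or_ne A G
    · exact hAcov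
    obtain ⟨w, hwX, hwA, hw⟩ := h.exists_private A hA
    rcases hAcov w hwX hwA with hw' | ⟨F', hF', hr, hw'⟩
    · exact absurd (hsub w hwX hw') (hw G hGD hAG.symm)
    · exact absurd hw' (hw F' hF' fun e => by simp [e] at hr)
  set r' := Function.update r F (r G) with hr'
  have hr'F : r' F = r G := by simp [hr']
  have hr'D : ∀ A ∈ D, r' A = r A := fun A hA =>
    Function.update_of_ne (ne_of_mem_of_not_mem hA hFD) _ _
  have mem_new : ∀ A ∈ D, A ≠ G → A ∈ insert F (D.erase G) := fun A hA hAG =>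
    Finset.mem_insert_of_mem (Finset.mem_erase.2 ⟨hAG, hA⟩)
  have later : ∀ n, ∀ v ∈ X, (∃ F' ∈ D, n < r F' ∧ v ∈ F') →
      ∃ F' ∈ insert F (D.erase G), n < r' F' ∧ v ∈ F' := by
    rintro n v hvX ⟨F', hF', hn, hv⟩
    obtain rfl | hne := eq_or_ne F' G
    · rcases hGcov v hvX hv with hvF | ⟨B, hB, hrB, hvB⟩
      · exact ⟨F, Finset.mem_insert_self _ _, by rwa [hr'F], hvF⟩
      · refine ⟨B, mem_new B hB fun e => by simp [e] at hrB, ?_, hvB⟩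
        rw [hr'D B hB]
        exact hn.trans hrB
    · exact ⟨F', mem_new F' hF' hne, by rwa [hr'D F' hF'], hv⟩
  refine ⟨insert F (D.erase G), r', ⟨?_, ?_, ?_, ?_⟩, ?_⟩
  · intro A hA
    rcases Finset.mem_insert.1 hA with rfl | hA
    · exact Finset.mem_erase.2 ⟨hFG, hF⟩
    · exact Finset.erase_subset_erase _ h.subset hA
  · intro v hvX
    obtain ⟨A, hA, hvA⟩ := h.cover v hvX
    obtain rfl | hAG := eq_or_ne A G
    · rcases hGcov v hvX hvA with hvF | ⟨B, hB, hrB, hvB⟩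
      · exact ⟨F, Finset.mem_insert_self _ _, hvF⟩
      · exact ⟨B, mem_new B hB fun e => by simp [e] at hrB, hvB⟩
    · exact ⟨A, mem_new A hA hAG, hvA⟩
  · intro A hA
    rcases Finset.mem_insert.1 hA with rfl | hA
    · obtain ⟨v, hvX, hvG, hv⟩ := h.exists_private G hGD
      refine ⟨v, hvX, ?_, fun F' hF' hne => ?_⟩
      · refine (hGcov v hvX hvG).resolve_right ?_
        rintro ⟨B, hB, hrB, hvB⟩
        exact hv B hB (fun e => by simp [e] at hrB) hvB
      · have hF'' := Finset.mem_of_mem_insert_of_ne hF' hne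
        exact hv F' (Finset.mem_of_mem_erase hF'') (Finset.ne_of_mem_erase hF'')
    · obtain ⟨hAG, hAD⟩ := Finset.mem_erase.1 hA
      obtain ⟨v, hvX, hvA, hv⟩ := h.exists_private A hAD
      refine ⟨v, hvX, hvA, fun F' hF' hne => ?_⟩
      rcases Finset.mem_insert.1 hF' with rfl | hF'
      · exact fun hvF => hv G hGD hAG.symm (hsub v hvX hvF)
      · exact hv F' (Finset.mem_of_mem_erase hF') hne
  · intro H hH hHD
    obtain ⟨hHG, hHΓ⟩ := Finset.mem_erase.1 hH
    obtain ⟨A, hA, hAcov⟩ := h.ordered H hHΓ fun e => hHD (mem_new H e hHG)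
    obtain rfl | hAG := eq_or_ne A G
    · refine ⟨F, Finset.mem_insert_self _ _, fun v hvX hvF => ?_⟩
      rw [hr'F]
      exact (hAcov v hvX (hsub v hvX hvF)).imp_right (later _ v hvX)
    · refine ⟨A, mem_new A hA hAG, fun v hvX hvA => ?_⟩
      rw [hr'D A hA]
      exact (hAcov v hvX hvA).imp_right (later _ v hvX)
  · have hF' : F ∉ D.erase G := fun e => hFD (Finset.mem_of_mem_erase e)
    rw [Finset.card_insert_of_notMem hF', Finset.card_erase_add_one hGD]

theorem IsSimplicialForest.mono {Γ Δ : Finset (Finset α)} (h : IsSimplicialForest Γ)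
    (hΔ : Δ ⊆ Γ) : IsSimplicialForest Δ :=
  fun Θ hΘ => h Θ (hΘ.trans hΔ)

theorem IsRankedCover.card_eq {Γ : Finset (Finset α)} (hforest : IsSimplicialForest Γ)
    {X : Finset α} {D₁ D₂ : Finset (Finset α)} {r₁ r₂ : Finset α → ℕ}
    (h₁ : IsRankedCover X Γ D₁ r₁) (h₂ : IsRankedCover X Γ D₂ r₂) : D₁.card = D₂.card := by
  induction hn : Γ.card generalizing Γ X D₁ D₂ r₁ r₂ with
  | zero =>
    obtain rfl := Finset.card_eq_zero.1 hn
    rw [Finset.subset_empty.1 h₁.subset, Finset.subset_empty.1 h₂.subset]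
  | succ n ih =>
    by_cases hred : ∃ F ∈ Γ, ∃ G ∈ Γ, F ≠ G ∧ ∀ v ∈ X, v ∈ F → v ∈ G
    · obtain ⟨F, hF, G, hG, hFG, hsub⟩ := hred
      obtain ⟨D₁', r₁', h₁', hc₁⟩ := h₁.exists_erase_of_subset hF hFG hsub
      obtain ⟨D₂', r₂', h₂', hc₂⟩ := h₂.exists_erase_of_subset hF hFG hsub
      rw [← hc₁, ← hc₂]
      exact ih (hforest.mono (Finset.erase_subset _ _)) h₁' h₂'
        (by rw [Finset.card_erase_of_mem hG, hn, Nat.add_sub_cancel])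
    by_cases hfree : ∃ F ∈ Γ, ∃ v ∈ X, v ∈ F ∧ ∀ H ∈ Γ, H ≠ F → v ∉ H
    · obtain ⟨F, hF, v, hvX, hvF, hv⟩ := hfree
      obtain ⟨hF₁, h₁'⟩ := h₁.erase_of_free hvX hvF hv
      obtain ⟨hF₂, h₂'⟩ := h₂.erase_of_free hvX hvF hv
      rw [← Finset.card_erase_add_one hF₁, ← Finset.card_erase_add_one hF₂]
      exact congrArg (· + 1) (ih (hforest.mono (Finset.erase_subset _ _)) h₁' h₂'
        (by rw [Finset.card_erase_of_mem hF, hn, Nat.add_sub_cancel]))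
    have hempty : ∀ {D : Finset (Finset α)} {r}, Γ.card = 1 → IsRankedCover X Γ D r → D = ∅ := by
      intro D r hΓ h
      refine Finset.eq_empty_of_forall_notMem fun A hA => hfree ?_
      obtain ⟨v, hvX, hvA, -⟩ := h.exists_private A hA
      exact ⟨A, h.subset hA, v, hvX, hvA, fun H hH hne =>
        absurd (Finset.card_le_one.1 hΓ.le H hH A (h.subset hA)) hne⟩
    obtain ⟨F, hF, hsing | ⟨G, hG, hGF, hleaf⟩⟩ :=
      hforest Γ subset_rfl (Finset.card_pos.1 (by omega))
    · have hΓ : Γ.card = 1 := by rw [hsing, Finset.card_singleton]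
      rw [hempty hΓ h₁, hempty hΓ h₂]
    · refine absurd ⟨F, hF, G, hG, hGF.symm, fun v hvX hvF => ?_⟩ hred
      by_contra hvG
      exact hfree ⟨F, hF, v, hvX, hvF, fun H hH hne hvH =>
        hvG (hleaf H hH hne (Finset.mem_inter.2 ⟨hvF, hvH⟩))⟩

theorem mem_listUnion {L : List (Finset α)} {v : α} : v ∈ listUnion L ↔ ∃ F ∈ L, v ∈ F := by
  induction L with
  | nil => simp [listUnion]
  | cons A L ih =>
    rw [List.exists_mem_cons_iff, ← ih]
    exact Finset.mem_union

/-- A well ordered facet cover is a ranked cover, ranked by position. -/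
theorem IsWellOrderedFacetCover.isRankedCover {V : Finset α} {Γ : Finset (Finset α)}
    {L : List (Finset α)} (h : IsWellOrderedFacetCover V Γ L) :
    IsRankedCover V Γ L.toFinset (fun F => L.idxOf F) := by
  obtain ⟨hnd, -, ⟨⟨hsub, hcov⟩, hmin⟩, hord⟩ := h
  refine ⟨hsub, hcov, fun F hF => ?_, fun H hH hHL => ?_⟩
  · by_contra! hF'
    refine hmin _ (Finset.erase_ssubset hF) ⟨(Finset.erase_subset _ _).trans hsub, fun v hv => ?_⟩
    obtain ⟨A, hA, hvA⟩ := hcov v hv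
    by_cases hAF : A = F
    · obtain ⟨B, hB, hBF, hvB⟩ := hF' v hv (hAF ▸ hvA)
      exact ⟨B, Finset.mem_erase.2 ⟨hBF, hB⟩, hvB⟩
    · exact ⟨A, Finset.mem_erase.2 ⟨hAF, hA⟩, hvA⟩
  · obtain ⟨i, hi, hcovi⟩ := hord H hH fun e => hHL (List.mem_toFinset.2 e)
    refine ⟨_, List.mem_toFinset.2 (List.get_mem L ⟨i, Nat.lt_of_succ_lt hi⟩), fun v _ hvF => ?_⟩
    refine (Finset.mem_union.1 (hcovi hvF)).imp_right fun hv => ?_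
    obtain ⟨B, hB, hvB⟩ := mem_listUnion.1 hv
    obtain ⟨j, hj, rfl⟩ := List.getElem_of_mem hB
    refine ⟨_, List.mem_toFinset.2 (List.mem_of_mem_drop hB), ?_, hvB⟩
    rw [List.getElem_drop, List.get_eq_getElem, hnd.idxOf_getElem, hnd.idxOf_getElem]
    change i < i + 1 + j
    omega

/-- All well ordered facet covers of a simplicial forest have the same cardinality. -/
theorem forest_wellOrderedFacetCovers_same_cardinality (Γ : Finset (Finset α))
    (hfacets : ∀ F ∈ Γ, ∀ G ∈ Γ, F ⊆ G → F = G)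
    (hne : ∀ F ∈ Γ, F.Nonempty) (hforest : IsSimplicialForest Γ)
    (L₁ L₂ : List (Finset α))
    (h₁ : IsWellOrderedFacetCover (vertexSet Γ) Γ L₁)
    (h₂ : IsWellOrderedFacetCover (vertexSet Γ) Γ L₂) :
    L₁.length = L₂.length := by
  rw [← List.toFinset_card_of_nodup h₁.1, ← List.toFinset_card_of_nodup h₂.1]
  exact h₁.isRankedCover.card_eq hforest h₂.isRankedCover
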